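/- arXiv:2202.11600 — 2 statements merged into one kernel-verified Lean document; each statement's English description precedes it below -/
import Mathlib

section
/- Let E be a finite-dimensional real inner product space, T > 0, m a natural number, and for each a ∈ {1,…,m} let X_a : E → E be a twice continuously differentiable vector field. Let c : ℝ → E be four times continuously differentiable on [0,T] and λ_a : ℝ → ℝ twice continuously differentiable. Define, for curves c̃ : ℝ → E and functions λ̃_a : ℝ → ℝ, the augmented functional J(c̃, λ̃) = ∫₀ᵀ ( ½‖c̃''(t)‖² + Σ_a λ̃_a(t) ⟪X_a(c̃(t)), c̃''(t)⟫ ) dt. Then for every twice continuously differentiable γ : ℝ → E with γ(0) = γ(T) = 0 and γ'(0) = γ'(T) = 0, and every continuous η_a : ℝ → ℝ, the function s ↦ J(c + sγ, λ + sη) is differentiable at s = 0 with derivative equal to ∫₀ᵀ [ ⟪c''''(t) + Σ_a ( λ_a''(t) X_a(c(t)) + 2λ_a'(t) (X_a∘c)'(t) + λ_a(t) (X_a∘c)''(t) ), γ(t)⟫ + Σ_a λ_a(t) ⟪(fderiv X_a (c(t)))(γ(t)), c''(t)⟫ + Σ_a η_a(t) ⟪X_a(c(t)), c''(t)⟫ ]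 dt. -/
open RealInnerProductSpace intervalIntegral

/-- Differentiation under the integral sign for a jointly continuous derivative. -/
theorem aux_param (T : ℝ) (hT : 0 < T) (F F' : ℝ → ℝ → ℝ)
    (hF : ∀ s, Continuous (F s)) (hF' : Continuous (fun p : ℝ × ℝ => F' p.1 p.2))
    (h : ∀ s t, HasDerivAt (fun s => F s t) (F' s t) s) :
    HasDerivAt (fun s => ∫ t in (0:ℝ)..T, F s t) (∫ t in (0:ℝ)..T, F' 0 t) 0 := by
  obtain ⟨C, hC⟩ := (((isCompact_Icc (a := (-1:ℝ)) (b := 1)).prod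
    (isCompact_Icc (a := (0:ℝ)) (b := T))).exists_bound_of_continuousOn hF'.continuousOn)
  have hF0 : Continuous (F' 0) := hF'.comp (Continuous.prodMk_right (0:ℝ))
  refine (intervalIntegral.hasDerivAt_integral_of_dominated_loc_of_deriv_le
    (s := Set.Icc (-1:ℝ) 1) (bound := fun _ => C)
    (Icc_mem_nhds (by norm_num) (by norm_num)) ?_ ?_ ?_ ?_ ?_ ?_).2
  · exact Filter.Eventually.of_forall fun s => (hF s).aestronglyMeasurable
  · exact (hF 0).intervalIntegrable _ _
  · exact hF0.aestronglyMeasurable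
  · refine Filter.Eventually.of_forall fun t ht s hs => ?_
    rw [Set.uIoc_of_le hT.le] at ht
    exact hC (s, t) ⟨hs, ht.1.le, ht.2⟩
  · exact intervalIntegrable_const
  · exact Filter.Eventually.of_forall fun t _ s _ => h s t

/-- Two-fold integration by parts. -/
theorem aux_parts {E : Type*} [NormedAddCommGroup E] [InnerProductSpace ℝ E]
    (T : ℝ) (W W1 W2 g g1 g2 : ℝ → E)
    (hW : ∀ t, HasDerivAt W (W1 t) t) (hW1 : ∀ t, HasDerivAt W1 (W2 t) t)
    (hg : ∀ t, HasDerivAt g (g1 t) t) (hg1 : ∀ t, HasDerivAt g1 (g2 t) t)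
    (cW2 : Continuous W2) (cg2 : Continuous g2)
    (h0 : g 0 = 0) (hT : g T = 0) (h0' : g1 0 = 0) (hT' : g1 T = 0) :
    ∫ t in (0:ℝ)..T, ⟪W t, g2 t⟫ = ∫ t in (0:ℝ)..T, ⟪W2 t, g t⟫ := by
  have cW : Continuous W := continuous_iff_continuousAt.2 fun t => (hW t).continuousAt
  have cg : Continuous g := continuous_iff_continuousAt.2 fun t => (hg t).continuousAt
  have i1 : IntervalIntegrable (fun t => ⟪W t, g2 t⟫) MeasureTheory.volume 0 T :=
    (cW.inner cg2).intervalIntegrable _ _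
  have i2 : IntervalIntegrable (fun t => ⟪W2 t, g t⟫) MeasureTheory.volume 0 T :=
    (cW2.inner cg).intervalIntegrable _ _
  have key := intervalIntegral.integral_eq_sub_of_hasDerivAt (a := 0) (b := T)
    (f := fun t => ⟪W t, g1 t⟫ - ⟪W1 t, g t⟫) (f' := fun t => ⟪W t, g2 t⟫ - ⟪W2 t, g t⟫)
    (fun t _ => by
      refine (((hW t).inner ℝ (hg1 t)).sub ((hW1 t).inner ℝ (hg t))).congr_deriv ?_
      ring) (i1.sub i2)
  rw [intervalIntegral.integral_sub i1 i2] at key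
  simp only [h0, hT, h0', hT', inner_zero_right, sub_zero] at key
  exact sub_eq_zero.1 key

theorem aux_d0 {E : Type*} [NormedAddCommGroup E] [NormedSpace ℝ E] (f : ℝ → E)
    (hf : ContDiff ℝ 2 f) (t : ℝ) : HasDerivAt f (deriv f t) t :=
  ((hf.differentiable (by norm_num)) t).hasDerivAt

theorem aux_d1 {E : Type*} [NormedAddCommGroup E] [NormedSpace ℝ E] (f : ℝ → E)
    (hf : ContDiff ℝ 2 f) (t : ℝ) : HasDerivAt (deriv f) (iteratedDeriv 2 f t) t := by
  have h := (hf.differentiable_iteratedDeriv 1 (by norm_num)) t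
  have h2 := h.hasDerivAt
  rw [← iteratedDeriv_succ, iteratedDeriv_one] at h2
  exact h2

theorem aux_c2 {E : Type*} [NormedAddCommGroup E] [NormedSpace ℝ E] (f : ℝ → E)
    (hf : ContDiff ℝ 2 f) : Continuous (iteratedDeriv 2 f) :=
  hf.continuous_iteratedDeriv 2 le_rfl

theorem aux_lin {E : Type*} [NormedAddCommGroup E] [NormedSpace ℝ E] (c γ : ℝ → E)
    (hc : ContDiff ℝ 2 c) (hγ : ContDiff ℝ 2 γ) (s t : ℝ) :
    iteratedDeriv 2 (fun u => c u + s • γ u) t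
      = iteratedDeriv 2 c t + s • iteratedDeriv 2 γ t := by
  have e1 : deriv (fun u => c u + s • γ u) = fun u => deriv c u + s • deriv γ u := by
    funext u
    exact ((aux_d0 c hc u).add ((aux_d0 γ hγ u).const_smul s)).deriv
  rw [iteratedDeriv_succ, iteratedDeriv_one, e1]
  exact ((aux_d1 c hc t).add ((aux_d1 γ hγ t).const_smul s)).deriv

/-- First-variation formula for the augmented Lagrangian of the constrained
minimal-acceleration problem (paper's Theorem 1, flat Euclidean setting):
`s ↦ J(c + sγ, λ + sη)` is differentiable at `s = 0` with the stated derivative. -/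
theorem stmt_6 {E : Type*} [NormedAddCommGroup E] [InnerProductSpace ℝ E]
    [FiniteDimensional ℝ E]
    (T : ℝ) (hT : 0 < T) (m : ℕ) (X : Fin m → E → E) (hX : ∀ a, ContDiff ℝ 2 (X a))
    (c : ℝ → E) (hc : ContDiff ℝ 4 c)
    (lam : Fin m → ℝ → ℝ) (hlam : ∀ a, ContDiff ℝ 2 (lam a))
    (γ : ℝ → E) (hγ : ContDiff ℝ 2 γ)
    (hγ0 : γ 0 = 0) (hγT : γ T = 0) (hγ'0 : deriv γ 0 = 0) (hγ'T : deriv γ T = 0)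
    (η : Fin m → ℝ → ℝ) (hη : ∀ a, Continuous (η a)) :
    HasDerivAt
      (fun s : ℝ => ∫ t in (0:ℝ)..T,
        (1/2 : ℝ) * ‖iteratedDeriv 2 (fun u => c u + s • γ u) t‖ ^ 2
          + ∑ a, (lam a t + s * η a t) *
              ⟪X a (c t + s • γ t), iteratedDeriv 2 (fun u => c u + s • γ u) t⟫)
      (∫ t in (0:ℝ)..T,
        ⟪iteratedDeriv 4 c t
            + ∑ a, ((iteratedDeriv 2 (lam a) t) • X a (c t)
                + (2 * deriv (lam a) t) • deriv (fun u => X a (c u)) t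
                + lam a t • iteratedDeriv 2 (fun u => X a (c u)) t), γ t⟫
          + ∑ a, lam a t * ⟪fderiv ℝ (X a) (c t) (γ t), iteratedDeriv 2 c t⟫
          + ∑ a, η a t * ⟪X a (c t), iteratedDeriv 2 c t⟫) 0 := by
  have hc2 : ContDiff ℝ 2 c := hc.of_le (by norm_num)
  have hXc : ∀ a, ContDiff ℝ 2 (fun u => X a (c u)) := fun a => (hX a).comp hc2
  have cc := hc2.continuous
  have cγ := hγ.continuous
  have cc2 := aux_c2 c hc2
  have cγ2 := aux_c2 γ hγ
  have cX := fun a => (hX a).continuous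
  have cl := fun a => (hlam a).continuous
  have cDX : ∀ a, Continuous (fderiv ℝ (X a)) := fun a => (hX a).continuous_fderiv (by norm_num)
  simp only [aux_lin c γ hc2 hγ]
  have main := aux_param T hT
    (fun s t => (1/2 : ℝ) * ‖iteratedDeriv 2 c t + s • iteratedDeriv 2 γ t‖ ^ 2
          + ∑ a, (lam a t + s * η a t) *
              ⟪X a (c t + s • γ t), iteratedDeriv 2 c t + s • iteratedDeriv 2 γ t⟫)
    (fun s t => ⟪iteratedDeriv 2 c t + s • iteratedDeriv 2 γ t, iteratedDeriv 2 γ t⟫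
          + ∑ a, (η a t *
              ⟪X a (c t + s • γ t), iteratedDeriv 2 c t + s • iteratedDeriv 2 γ t⟫
            + (lam a t + s * η a t) *
              (⟪X a (c t + s • γ t), iteratedDeriv 2 γ t⟫
              + ⟪fderiv ℝ (X a) (c t + s • γ t) (γ t),
                  iteratedDeriv 2 c t + s • iteratedDeriv 2 γ t⟫)))
    (fun s => by fun_prop) ?_ ?_
  · convert main using 1
    -- integration by parts
    have hc4 : ∀ t, HasDerivAt (iteratedDeriv 2 c) (iteratedDeriv 3 c t) t := fun t => by
      rw [iteratedDeriv_succ (n := 2)]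
      exact ((hc.differentiable_iteratedDeriv 2 (by norm_num)) t).hasDerivAt
    have hc5 : ∀ t, HasDerivAt (iteratedDeriv 3 c) (iteratedDeriv 4 c t) t := fun t => by
      rw [iteratedDeriv_succ (n := 3)]
      exact ((hc.differentiable_iteratedDeriv 3 (by norm_num)) t).hasDerivAt
    have cc4 : Continuous (iteratedDeriv 4 c) := hc.continuous_iteratedDeriv 4 le_rfl
    have cl1 : ∀ a, Continuous (deriv (lam a)) := fun a => (hlam a).continuous_deriv (by norm_num)
    have cl2 := fun a => aux_c2 _ (hlam a)
    have cX1 : ∀ a, Continuous (deriv (fun u => X a (c u))) :=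
      fun a => (hXc a).continuous_deriv (by norm_num)
    have cX2 := fun a => aux_c2 _ (hXc a)
    have cW2 : Continuous (fun t => iteratedDeriv 4 c t
            + ∑ a, ((iteratedDeriv 2 (lam a) t) • X a (c t)
                + (2 * deriv (lam a) t) • deriv (fun u => X a (c u)) t
                + lam a t • iteratedDeriv 2 (fun u => X a (c u)) t)) := by
      fun_prop
    have parts := aux_parts T
      (fun t => iteratedDeriv 2 c t + ∑ a, lam a t • X a (c t))
      (fun t => iteratedDeriv 3 c t + ∑ a, (lam a t • deriv (fun u => X a (c u)) t
        + deriv (lam a) t • X a (c t)))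
      (fun t => iteratedDeriv 4 c t
            + ∑ a, ((iteratedDeriv 2 (lam a) t) • X a (c t)
                + (2 * deriv (lam a) t) • deriv (fun u => X a (c u)) t
                + lam a t • iteratedDeriv 2 (fun u => X a (c u)) t))
      γ (deriv γ) (iteratedDeriv 2 γ)
      (fun t => (hc4 t).add (HasDerivAt.fun_sum fun a _ =>
        (aux_d0 _ (hlam a) t).smul (aux_d0 _ (hXc a) t)))
      (fun t => by
        refine (hc5 t).add (HasDerivAt.fun_sum fun a _ => ?_)
        refine (((aux_d0 _ (hlam a) t).smul (aux_d1 _ (hXc a) t)).add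
          ((aux_d1 _ (hlam a) t).smul (aux_d0 _ (hXc a) t))).congr_deriv ?_
        module)
      (aux_d0 γ hγ) (aux_d1 γ hγ) cW2 cγ2 hγ0 hγT hγ'0 hγ'T
    have cR : Continuous (fun t => ∑ a, lam a t * ⟪fderiv ℝ (X a) (c t) (γ t), iteratedDeriv 2 c t⟫
          + ∑ a, η a t * ⟪X a (c t), iteratedDeriv 2 c t⟫) := by
      fun_prop
    have cW : Continuous (fun t => iteratedDeriv 2 c t + ∑ a, lam a t • X a (c t)) := by
      fun_prop
    simp only [add_assoc] at parts cW2 ⊢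
    rw [intervalIntegral.integral_add ((cW2.inner cγ).intervalIntegrable _ _)
      (cR.intervalIntegrable _ _), ← parts, ← intervalIntegral.integral_add
      ((cW.inner cγ2).intervalIntegrable _ _) (cR.intervalIntegrable _ _)]
    refine intervalIntegral.integral_congr fun t _ => ?_
    simp only [zero_smul, add_zero, zero_mul, inner_add_left, sum_inner, real_inner_smul_left,
      mul_add, Finset.sum_add_distrib]
    ring
  · fun_prop
  · intro s t
    have hv : HasDerivAt (fun s : ℝ => iteratedDeriv 2 c t + s • iteratedDeriv 2 γ t)
        (iteratedDeriv 2 γ t) s := by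
      simpa using ((hasDerivAt_id s).smul_const (iteratedDeriv 2 γ t)).const_add
        (iteratedDeriv 2 c t)
    have hp : HasDerivAt (fun s : ℝ => c t + s • γ t) (γ t) s := by
      simpa using ((hasDerivAt_id s).smul_const (γ t)).const_add (c t)
    refine HasDerivAt.add ?_ (HasDerivAt.fun_sum fun a _ => ?_)
    · refine ((hv.norm_sq).const_mul (1/2 : ℝ)).congr_deriv ?_
      ring
    · have hl : HasDerivAt (fun s : ℝ => lam a t + s * η a t) (η a t) s := by
        simpa using ((hasDerivAt_id s).mul_const (η a t)).const_add (lam a t)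
      have hx : HasDerivAt (fun s : ℝ => X a (c t + s • γ t))
          (fderiv ℝ (X a) (c t + s • γ t) (γ t)) s :=
        (((hX a).differentiable (by norm_num)) _).hasFDerivAt.comp_hasDerivAt s hp
      refine (hl.mul (hx.inner ℝ hv)).congr_deriv ?_
      ring
end

section
/- (Planar rigid body with underactuation constraint.) Let m > 0, J > 0, T > 0. Let x, y, θ : ℝ → ℝ be four times continuously differentiable on [0,T] and λ : ℝ → ℝ twice continuously differentiable. Define the augmented action A(x̃, ỹ, θ̃, λ̃) = ∫₀ᵀ [ ½( m x̃''(t)² + m ỹ''(t)² + J θ̃''(t)² ) + λ̃(t) ( sin(θ̃(t)) x̃''(t) − cos(θ̃(t)) ỹ''(t) ) ] dt. Suppose that for all smooth γ₁, γ₂, γ₃ : ℝ → ℝ vanishing together with their first derivatives at t = 0 and t = T, and all smooth η : ℝ → ℝ, the derivative at s = 0 of s ↦ A(x + sγ₁, y + sγ₂, θ + sγ₃, λ + sη) is zero. Then for all t ∈ [0,T]: sin θ · x'' − cos θ · y'' = 0, and x'''' + (λ''/m) sin θ + 2(λ'/m) θ' cos θ + (λ/m)(θ'' cos θ − (θ')²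 sin θ) = 0, y'''' − (λ''/m) cos θ + 2(λ'/m) θ' sin θ + (λ/m)(θ'' sin θ + (θ')² cos θ) = 0, θ'''' + (λ/J)(cos θ · x'' + sin θ · y'') = 0. -/
open intervalIntegral

theorem aux_hasDerivAt (T : ℝ) (hT : 0 < T) (F F' : ℝ → ℝ → ℝ)
    (hF : Continuous (fun p : ℝ × ℝ => F p.1 p.2))
    (hF' : Continuous (fun p : ℝ × ℝ => F' p.1 p.2))
    (hd : ∀ s t, HasDerivAt (fun s => F s t) (F' s t) s) :
    HasDerivAt (fun s => ∫ t in (0:ℝ)..T, F s t) (∫ t in (0:ℝ)..T, F' 0 t) 0 := by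
  have hc : ∀ s, Continuous (F s) := fun s =>
    hF.comp (continuous_const.prodMk continuous_id)
  have hc' : ∀ s, Continuous (F' s) := fun s =>
    hF'.comp (continuous_const.prodMk continuous_id)
  obtain ⟨C, hC⟩ := ((isCompact_Icc (a := (-1:ℝ)) (b := 1)).prod
    (isCompact_Icc (a := (0:ℝ)) (b := T))).exists_bound_of_continuousOn hF'.continuousOn
  refine (intervalIntegral.hasDerivAt_integral_of_dominated_loc_of_deriv_le
    (s := Set.Icc (-1:ℝ) 1) (bound := fun _ => C)
    (Icc_mem_nhds (by norm_num) (by norm_num)) ?_ ?_ ?_ ?_ ?_ ?_).2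
  · exact Filter.Eventually.of_forall fun s => (hc s).aestronglyMeasurable
  · exact (hc 0).intervalIntegrable _ _
  · exact (hc' 0).aestronglyMeasurable
  · refine Filter.Eventually.of_forall fun t ht s hs => ?_
    rw [Set.uIoc_of_le hT.le] at ht
    exact hC (s, t) ⟨hs, ht.1.le, ht.2⟩
  · exact intervalIntegrable_const
  · exact Filter.Eventually.of_forall fun t _ s _ => hd s t

theorem aux_fund (T : ℝ) (hT : 0 < T) (f f1 f2 g : ℝ → ℝ)
    (h1 : ∀ t, HasDerivAt f (f1 t) t) (h2 : ∀ t, HasDerivAt f1 (f2 t) t)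
    (hf2 : Continuous f2) (hg : Continuous g)
    (H : ∀ γ : ℝ → ℝ, ContDiff ℝ (⊤ : ℕ∞) γ → γ 0 = 0 → γ T = 0 → deriv γ 0 = 0 →
      deriv γ T = 0 → ∫ t in (0:ℝ)..T, (f t * iteratedDeriv 2 γ t + g t * γ t) = 0) :
    ∀ t ∈ Set.Icc (0:ℝ) T, f2 t + g t = 0 := by
  have hcf : Continuous f := continuous_iff_continuousAt.2 fun t => (h1 t).continuousAt
  have hcf1 : Continuous f1 := continuous_iff_continuousAt.2 fun t => (h2 t).continuousAt
  have hae : ∀ᵐ t, t ∈ Set.Ioo (0:ℝ) T → f2 t + g t = 0 := by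
    refine isOpen_Ioo.ae_eq_zero_of_integral_contDiff_smul_eq_zero
      ((hf2.add hg).locallyIntegrable.locallyIntegrableOn _) ?_
    intro γ hγ hsupp hsub
    have h0 : (0:ℝ) ∉ tsupport γ := fun h => lt_irrefl _ (hsub h).1
    have hT' : T ∉ tsupport γ := fun h => lt_irrefl _ (hsub h).2
    have g0 := image_eq_zero_of_notMem_tsupport h0
    have gT := image_eq_zero_of_notMem_tsupport hT'
    have d0 : deriv γ 0 = 0 := by
      by_contra h
      exact h0 (support_deriv_subset h)
    have dT : deriv γ T = 0 := by
      by_contra h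
      exact hT' (support_deriv_subset h)
    have hH := H γ hγ g0 gT d0 dT
    have hγ2 : ContDiff ℝ 2 γ := contDiff_infty.1 hγ 2
    have hγ1 : ContDiff ℝ 1 (deriv γ) := ((contDiff_succ_iff_deriv (n := 1)).1 hγ2).2.2
    have e1 : ∀ t, HasDerivAt γ (deriv γ t) t := fun t =>
      (hγ2.differentiable (by norm_num) t).hasDerivAt
    have e2 : ∀ t, HasDerivAt (deriv γ) (iteratedDeriv 2 γ t) t := fun t => by
      rw [iteratedDeriv_succ, iteratedDeriv_one]
      exact (hγ1.differentiable (by norm_num) t).hasDerivAt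
    have c2 : Continuous (iteratedDeriv 2 γ) := hγ2.continuous_iteratedDeriv 2 le_rfl
    have c1 := hγ1.continuous
    have c0 := hγ2.continuous
    -- the total derivative used to integrate by parts twice
    have key : ∫ t in (0:ℝ)..T, (f t * iteratedDeriv 2 γ t - f2 t * γ t) = 0 := by
      rw [intervalIntegral.integral_eq_sub_of_hasDerivAt
        (f := fun t => f t * deriv γ t - f1 t * γ t)]
      · simp [g0, gT, d0, dT]
      · intro t _
        exact (((h1 t).mul (e2 t)).sub ((h2 t).mul (e1 t))).congr_deriv (by ring)
      · exact Continuous.intervalIntegrable (by fun_prop) _ _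
    have hz : ∫ t in (0:ℝ)..T, γ t • (f2 t + g t) = 0 := by
      have : (fun t => γ t • (f2 t + g t)) = fun t =>
          (f t * iteratedDeriv 2 γ t + g t * γ t) - (f t * iteratedDeriv 2 γ t - f2 t * γ t) := by
        funext t; simp only [smul_eq_mul]; ring
      rw [this, intervalIntegral.integral_sub, hH, key, sub_zero]
      · exact Continuous.intervalIntegrable (by fun_prop) _ _
      · exact Continuous.intervalIntegrable (by fun_prop) _ _
    rw [← hz, intervalIntegral.integral_of_le hT.le]
    symm
    apply MeasureTheory.setIntegral_eq_integral_of_forall_compl_eq_zero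
    intro t ht
    have : t ∉ tsupport γ := fun h => ht ⟨(hsub h).1, (hsub h).2.le⟩
    simp [image_eq_zero_of_notMem_tsupport this]
  have hIoo : Set.EqOn (fun t => f2 t + g t) (fun _ => 0) (Set.Ioo 0 T) := by
    refine MeasureTheory.Measure.eqOn_open_of_ae_eq (μ := MeasureTheory.volume) ?_ isOpen_Ioo
      (hf2.add hg).continuousOn continuousOn_const
    exact (MeasureTheory.ae_restrict_iff' measurableSet_Ioo).2 hae
  have := hIoo.closure (hf2.add hg) continuous_const
  rw [closure_Ioo hT.ne] at this
  exact fun t ht => this ht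

theorem aux_id2 (x γ : ℝ → ℝ) (hx : ContDiff ℝ 2 x) (hγ : ContDiff ℝ 2 γ) (s t : ℝ) :
    iteratedDeriv 2 (fun u => x u + s * γ u) t
      = iteratedDeriv 2 x t + s * iteratedDeriv 2 γ t := by
  rw [iteratedDeriv_fun_add (n := 2) hx.contDiffAt (contDiff_const.mul hγ).contDiffAt,
    iteratedDeriv_const_mul_field]

theorem aux_hd (x : ℝ → ℝ) (n k : ℕ) (hx : ContDiff ℝ n x) (hk : k < n) (t : ℝ) :
    HasDerivAt (iteratedDeriv k x) (iteratedDeriv (k + 1) x t) t := by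
  rw [iteratedDeriv_succ]
  exact (hx.differentiable_iteratedDeriv k (by exact_mod_cast hk) t).hasDerivAt

/-- The paper's planar rigid body example of Theorem 1: necessary conditions for
normal extremals of the augmented action
`A = ∫₀ᵀ ½(m ẍ² + m ÿ² + J θ̈²) + λ (sin θ · ẍ − cos θ · ÿ) dt`. -/
theorem stmt_9 (m J T : ℝ) (hm : 0 < m) (hJ : 0 < J) (hT : 0 < T)
    (x y θ : ℝ → ℝ) (lam : ℝ → ℝ)
    (hx : ContDiff ℝ 4 x) (hy : ContDiff ℝ 4 y) (hθ : ContDiff ℝ 4 θ)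
    (hlam : ContDiff ℝ 2 lam)
    (hcrit : ∀ γ₁ γ₂ γ₃ η : ℝ → ℝ,
      ContDiff ℝ (⊤ : ℕ∞) γ₁ → ContDiff ℝ (⊤ : ℕ∞) γ₂ → ContDiff ℝ (⊤ : ℕ∞) γ₃ → ContDiff ℝ (⊤ : ℕ∞) η →
      γ₁ 0 = 0 → γ₁ T = 0 → deriv γ₁ 0 = 0 → deriv γ₁ T = 0 →
      γ₂ 0 = 0 → γ₂ T = 0 → deriv γ₂ 0 = 0 → deriv γ₂ T = 0 →
      γ₃ 0 = 0 → γ₃ T = 0 → deriv γ₃ 0 = 0 → deriv γ₃ T = 0 →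
      deriv (fun s : ℝ => ∫ t in (0:ℝ)..T,
        (1/2 : ℝ) * (m * (iteratedDeriv 2 (fun u => x u + s * γ₁ u) t) ^ 2
            + m * (iteratedDeriv 2 (fun u => y u + s * γ₂ u) t) ^ 2
            + J * (iteratedDeriv 2 (fun u => θ u + s * γ₃ u) t) ^ 2)
          + (lam t + s * η t) *
              (Real.sin (θ t + s * γ₃ t) * iteratedDeriv 2 (fun u => x u + s * γ₁ u) t
                - Real.cos (θ t + s * γ₃ t) * iteratedDeriv 2 (fun u => y u + s * γ₂ u) t)) 0
        = 0) :
    ∀ t ∈ Set.Icc (0:ℝ) T,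
      Real.sin (θ t) * iteratedDeriv 2 x t - Real.cos (θ t) * iteratedDeriv 2 y t = 0 ∧
      iteratedDeriv 4 x t + (iteratedDeriv 2 lam t / m) * Real.sin (θ t)
          + 2 * (deriv lam t / m) * deriv θ t * Real.cos (θ t)
          + (lam t / m) * (iteratedDeriv 2 θ t * Real.cos (θ t)
              - (deriv θ t) ^ 2 * Real.sin (θ t)) = 0 ∧
      iteratedDeriv 4 y t - (iteratedDeriv 2 lam t / m) * Real.cos (θ t)
          + 2 * (deriv lam t / m) * deriv θ t * Real.sin (θ t)
          + (lam t / m) * (iteratedDeriv 2 θ t * Real.sin (θ t)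
              + (deriv θ t) ^ 2 * Real.cos (θ t)) = 0 ∧
      iteratedDeriv 4 θ t + (lam t / J) * (Real.cos (θ t) * iteratedDeriv 2 x t
          + Real.sin (θ t) * iteratedDeriv 2 y t) = 0 := by
  have hx2 : ContDiff ℝ 2 x := hx.of_le (by norm_num)
  have hy2 : ContDiff ℝ 2 y := hy.of_le (by norm_num)
  have hθ2 : ContDiff ℝ 2 θ := hθ.of_le (by norm_num)
  have cX : Continuous (iteratedDeriv 2 x) := hx2.continuous_iteratedDeriv 2 le_rfl
  have cY : Continuous (iteratedDeriv 2 y) := hy2.continuous_iteratedDeriv 2 le_rfl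
  have cΘ : Continuous (iteratedDeriv 2 θ) := hθ2.continuous_iteratedDeriv 2 le_rfl
  have cL : Continuous (iteratedDeriv 2 lam) := hlam.continuous_iteratedDeriv 2 le_rfl
  have cX4 : Continuous (iteratedDeriv 4 x) := hx.continuous_iteratedDeriv 4 le_rfl
  have cY4 : Continuous (iteratedDeriv 4 y) := hy.continuous_iteratedDeriv 4 le_rfl
  have cΘ4 : Continuous (iteratedDeriv 4 θ) := hθ.continuous_iteratedDeriv 4 le_rfl
  have cθ := hθ.continuous
  have cl := hlam.continuous
  have cθ1 : Continuous (deriv θ) := hθ2.continuous_deriv (by norm_num)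
  have cl1 : Continuous (deriv lam) := hlam.continuous_deriv (by norm_num)
  have dθ : ∀ t, HasDerivAt θ (deriv θ t) t := fun t => by
    simpa using aux_hd θ 2 0 hθ2 (by norm_num) t
  have dθ1 : ∀ t, HasDerivAt (deriv θ) (iteratedDeriv 2 θ t) t := fun t => by
    simpa only [iteratedDeriv_one] using aux_hd θ 2 1 hθ2 (by norm_num) t
  have dl : ∀ t, HasDerivAt lam (deriv lam t) t := fun t => by
    simpa using aux_hd lam 2 0 hlam (by norm_num) t
  have dl1 : ∀ t, HasDerivAt (deriv lam) (iteratedDeriv 2 lam t) t := fun t => by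
    simpa only [iteratedDeriv_one] using aux_hd lam 2 1 hlam (by norm_num) t
  -- first variation formula
  have var : ∀ γ₁ γ₂ γ₃ η : ℝ → ℝ,
      ContDiff ℝ (⊤ : ℕ∞) γ₁ → ContDiff ℝ (⊤ : ℕ∞) γ₂ → ContDiff ℝ (⊤ : ℕ∞) γ₃ →
      ContDiff ℝ (⊤ : ℕ∞) η →
      γ₁ 0 = 0 → γ₁ T = 0 → deriv γ₁ 0 = 0 → deriv γ₁ T = 0 →
      γ₂ 0 = 0 → γ₂ T = 0 → deriv γ₂ 0 = 0 → deriv γ₂ T = 0 →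
      γ₃ 0 = 0 → γ₃ T = 0 → deriv γ₃ 0 = 0 → deriv γ₃ T = 0 →
      ∫ t in (0:ℝ)..T, ((m * iteratedDeriv 2 x t * iteratedDeriv 2 γ₁ t
          + m * iteratedDeriv 2 y t * iteratedDeriv 2 γ₂ t
          + J * iteratedDeriv 2 θ t * iteratedDeriv 2 γ₃ t)
        + η t * (Real.sin (θ t) * iteratedDeriv 2 x t - Real.cos (θ t) * iteratedDeriv 2 y t)
        + lam t * (Real.sin (θ t) * iteratedDeriv 2 γ₁ t - Real.cos (θ t) * iteratedDeriv 2 γ₂ t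
          + γ₃ t * (Real.cos (θ t) * iteratedDeriv 2 x t
            + Real.sin (θ t) * iteratedDeriv 2 y t))) = 0 := by
    intro γ₁ γ₂ γ₃ η h1 h2 h3 h4 a1 a2 a3 a4 b1 b2 b3 b4 c1 c2 c3 c4
    have hh := hcrit γ₁ γ₂ γ₃ η h1 h2 h3 h4 a1 a2 a3 a4 b1 b2 b3 b4 c1 c2 c3 c4
    have h1' : ContDiff ℝ 2 γ₁ := contDiff_infty.1 h1 2
    have h2' : ContDiff ℝ 2 γ₂ := contDiff_infty.1 h2 2
    have h3' : ContDiff ℝ 2 γ₃ := contDiff_infty.1 h3 2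
    simp only [aux_id2 x γ₁ hx2 h1', aux_id2 y γ₂ hy2 h2', aux_id2 θ γ₃ hθ2 h3'] at hh
    have k1 : Continuous (iteratedDeriv 2 γ₁) := h1'.continuous_iteratedDeriv 2 le_rfl
    have k2 : Continuous (iteratedDeriv 2 γ₂) := h2'.continuous_iteratedDeriv 2 le_rfl
    have k3 : Continuous (iteratedDeriv 2 γ₃) := h3'.continuous_iteratedDeriv 2 le_rfl
    have k4 := h3.continuous
    have k5 := h4.continuous
    generalize iteratedDeriv 2 γ₁ = p at *
    generalize iteratedDeriv 2 γ₂ = q at *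
    generalize iteratedDeriv 2 γ₃ = r at *
    generalize iteratedDeriv 2 x = X at *
    generalize iteratedDeriv 2 y = Y at *
    generalize iteratedDeriv 2 θ = Z at *
    have D := aux_hasDerivAt T hT
      (fun s t => (1/2 : ℝ) * (m * (X t + s * p t) ^ 2 + m * (Y t + s * q t) ^ 2
            + J * (Z t + s * r t) ^ 2)
          + (lam t + s * η t) *
              (Real.sin (θ t + s * γ₃ t) * (X t + s * p t)
                - Real.cos (θ t + s * γ₃ t) * (Y t + s * q t)))
      (fun s t => (m * (X t + s * p t) * p t + m * (Y t + s * q t) * q t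
            + J * (Z t + s * r t) * r t)
          + η t * (Real.sin (θ t + s * γ₃ t) * (X t + s * p t)
                - Real.cos (θ t + s * γ₃ t) * (Y t + s * q t))
          + (lam t + s * η t) * (Real.sin (θ t + s * γ₃ t) * p t
              - Real.cos (θ t + s * γ₃ t) * q t
              + γ₃ t * (Real.cos (θ t + s * γ₃ t) * (X t + s * p t)
                + Real.sin (θ t + s * γ₃ t) * (Y t + s * q t))))
      (by fun_prop) (by fun_prop) ?_
    · have := D.deriv.symm.trans hh
      simpa using this
    · intro s t
      have lin : ∀ a b : ℝ, HasDerivAt (fun s : ℝ => a + s * b) b s := fun a b => by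
        simpa using ((hasDerivAt_id s).mul_const b).const_add a
      have dX := lin (X t) (p t)
      have dY := lin (Y t) (q t)
      have dZ := lin (Z t) (r t)
      have dT := lin (θ t) (γ₃ t)
      have dL := lin (lam t) (η t)
      refine HasDerivAt.congr_deriv ((((((dX.pow 2).const_mul m).add ((dY.pow 2).const_mul m)).add
        ((dZ.pow 2).const_mul J)).const_mul (1/2 : ℝ)).add
        (dL.mul ((dT.sin.mul dX).sub (dT.cos.mul dY)))) ?_
      simp
      ring
  have z0 : ∀ t, iteratedDeriv 2 (fun _ : ℝ => (0:ℝ)) t = 0 := fun t => by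
    simp [iteratedDeriv_succ]
  have zc : ContDiff ℝ (⊤ : ℕ∞) (fun _ : ℝ => (0:ℝ)) := contDiff_const
  have E0 := aux_fund T hT (fun _ => 0) (fun _ => 0) (fun _ => 0)
    (fun t => Real.sin (θ t) * iteratedDeriv 2 x t - Real.cos (θ t) * iteratedDeriv 2 y t)
    (fun t => hasDerivAt_const _ _) (fun t => hasDerivAt_const _ _) continuous_const
    (by fun_prop) (fun γ hγ _ _ _ _ => by
      have := var _ _ _ γ zc zc zc hγ (by simp) (by simp) (by simp) (by simp) (by simp) (by simp)
        (by simp) (by simp) (by simp) (by simp) (by simp) (by simp)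
      refine Eq.trans ?_ this
      congr 1; funext t
      simp only [z0]; ring)
  have E1 := aux_fund T hT (fun t => m * iteratedDeriv 2 x t + lam t * Real.sin (θ t))
    (fun t => m * iteratedDeriv 3 x t + (deriv lam t * Real.sin (θ t)
      + lam t * (Real.cos (θ t) * deriv θ t)))
    (fun t => m * iteratedDeriv 4 x t + ((iteratedDeriv 2 lam t * Real.sin (θ t)
      + deriv lam t * (Real.cos (θ t) * deriv θ t))
      + (deriv lam t * (Real.cos (θ t) * deriv θ t)
      + lam t * (-Real.sin (θ t) * deriv θ t * deriv θ t
        + Real.cos (θ t) * iteratedDeriv 2 θ t))))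
    (fun t => 0)
    (fun t => ((aux_hd x 4 2 hx (by norm_num) t).const_mul m).add ((dl t).mul (dθ t).sin))
    (fun t => ((aux_hd x 4 3 hx (by norm_num) t).const_mul m).add
      (((dl1 t).mul (dθ t).sin).add ((dl t).mul ((dθ t).cos.mul (dθ1 t)))))
    (by fun_prop) continuous_const (fun γ hγ a b c d => by
      have := var γ _ _ _ hγ zc zc zc a b c d (by simp) (by simp)
        (by simp) (by simp) (by simp) (by simp) (by simp) (by simp)
      refine Eq.trans ?_ this
      congr 1; funext t
      simp only [z0]; ring)
  have E2 := aux_fund T hT (fun t => m * iteratedDeriv 2 y t - lam t * Real.cos (θ t))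
    (fun t => m * iteratedDeriv 3 y t - (deriv lam t * Real.cos (θ t)
      + lam t * (-Real.sin (θ t) * deriv θ t)))
    (fun t => m * iteratedDeriv 4 y t - ((iteratedDeriv 2 lam t * Real.cos (θ t)
      + deriv lam t * (-Real.sin (θ t) * deriv θ t))
      + (deriv lam t * (-Real.sin (θ t) * deriv θ t)
      + lam t * (-(Real.cos (θ t) * deriv θ t) * deriv θ t
        + -Real.sin (θ t) * iteratedDeriv 2 θ t))))
    (fun t => 0)
    (fun t => ((aux_hd y 4 2 hy (by norm_num) t).const_mul m).sub ((dl t).mul (dθ t).cos))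
    (fun t => ((aux_hd y 4 3 hy (by norm_num) t).const_mul m).sub
      (((dl1 t).mul (dθ t).cos).add ((dl t).mul ((dθ t).sin.neg.mul (dθ1 t)))))
    (by fun_prop) continuous_const (fun γ hγ a b c d => by
      have := var _ γ _ _ zc hγ zc zc (by simp) (by simp)
        (by simp) (by simp) a b c d (by simp) (by simp) (by simp) (by simp)
      refine Eq.trans ?_ this
      congr 1; funext t
      simp only [z0]; ring)
  have E3 := aux_fund T hT (fun t => J * iteratedDeriv 2 θ t)
    (fun t => J * iteratedDeriv 3 θ t) (fun t => J * iteratedDeriv 4 θ t)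
    (fun t => lam t * (Real.cos (θ t) * iteratedDeriv 2 x t
            + Real.sin (θ t) * iteratedDeriv 2 y t))
    (fun t => (aux_hd θ 4 2 hθ (by norm_num) t).const_mul J)
    (fun t => (aux_hd θ 4 3 hθ (by norm_num) t).const_mul J)
    (by fun_prop) (by fun_prop) (fun γ hγ a b c d => by
      have := var _ _ γ _ zc zc hγ zc (by simp) (by simp)
        (by simp) (by simp) (by simp) (by simp) (by simp) (by simp) a b c d
      refine Eq.trans ?_ this
      congr 1; funext t
      simp only [z0]; ring)
  intro t ht
  have e0 := E0 t ht
  have e1 := E1 t ht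
  have e2 := E2 t ht
  have e3 := E3 t ht
  refine ⟨by simpa using e0, ?_, ?_, ?_⟩
  · field_simp
    linear_combination e1
  · field_simp
    linear_combination e2
  · field_simp
    linear_combination e3
end
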